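/- arXiv:0812.1595 — 5 statements merged into one kernel-verified Lean document; each statement's English description precedes it below -/
import Mathlib

section
/- Let I be a finite set of points in the Euclidean plane, let o be a depot point, and let k ≥ 1 be an integer. For every CVRP solution for (I, o, k), the total length of the solution is at least Rad(I) := (2/k) · Σ_{i ∈ I} dist(i, o). -/
open scoped BigOperators

noncomputable section

/-- Points of the Euclidean plane. -/
abbrev Point : Type := EuclideanSpace ℝ (Fin 2)

/-- The length of the closed polygonal tour visiting the points of `l` in order
and returning to the first point. -/
def cycleLength : List Point → ℝ
  | [] => 0
  | p :: rest => (List.zipWith dist (p :: rest) (rest ++ [p])).sum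

/-- The length of the closed walk starting and ending at the depot `o` and
visiting the points of `l` in order; `0` for the empty list. -/
def tourLength (o : Point) (l : List Point) : ℝ := cycleLength (o :: l)

/-- A CVRP solution for `(I, o, k)`: a finite family of tours, each visiting at
most `k` points, whose union covers all points of `I`. -/
def IsCVRPSolution (I : Finset Point) (k : ℕ) (tours : List (List Point)) : Prop :=
  (∀ t ∈ tours, t.length ≤ k) ∧ ∀ p ∈ I, ∃ t ∈ tours, p ∈ t

/-- The total length of a family of tours from the depot `o`. -/
def totalLength (o : Point) (tours : List (List Point)) : ℝ :=
  (tours.map (tourLength o)).sum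


theorem dist_le_sum_zipWith_dist {α : Type*} [PseudoMetricSpace α] (a b : α) (l : List α) :
    dist a b ≤ (List.zipWith dist (a :: l) (l ++ [b])).sum := by
  induction l generalizing a with
  | nil => simp
  | cons c l ih =>
    simp only [List.cons_append, List.zipWith_cons_cons, List.sum_cons] at ih ⊢
    linarith [ih c, dist_triangle a c b]

theorem dist_add_dist_le_sum_zipWith_dist {α : Type*} [PseudoMetricSpace α] (a b : α)
    {p : α} {l : List α} (hp : p ∈ l) :
    dist a p + dist p b ≤ (List.zipWith dist (a :: l) (l ++ [b])).sum := by
  induction l generalizing a with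
  | nil => simp at hp
  | cons c l ih =>
    simp only [List.cons_append, List.zipWith_cons_cons, List.sum_cons]
    rcases List.mem_cons.1 hp with rfl | hp
    · linarith [dist_le_sum_zipWith_dist p b l]
    · linarith [ih c hp, dist_triangle a c p]

theorem tourLength_nonneg (o : Point) (l : List Point) : 0 ≤ tourLength o l :=
  dist_nonneg.trans (dist_le_sum_zipWith_dist o o l)

theorem two_mul_dist_le_tourLength (o : Point) {p : Point} {l : List Point} (hp : p ∈ l) :
    2 * dist p o ≤ tourLength o l := by
  have h : dist o p + dist p o ≤ tourLength o l := dist_add_dist_le_sum_zipWith_dist o o hp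
  rw [dist_comm o p] at h
  linarith

theorem two_mul_sum_dist_le_tourLength (o : Point) {k : ℕ} {l : List Point}
    (hl : l.length ≤ k) :
    (l.map fun p => 2 * dist p o).sum ≤ k * tourLength o l := by
  have h : (l.map fun p => 2 * dist p o).sum ≤ l.length * tourLength o l := by
    simpa using List.sum_le_card_nsmul (l.map fun p => 2 * dist p o) (tourLength o l)
      (by simpa using fun p hp => two_mul_dist_le_tourLength o hp)
  exact h.trans (by gcongr; exact tourLength_nonneg o l)

theorem Finset.sum_le_list_sum_map {α : Type*} {f : α → ℝ} (hf : ∀ a, 0 ≤ f a)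
    {s : Finset α} {l : List α} (h : ∀ a ∈ s, a ∈ l) :
    ∑ a ∈ s, f a ≤ (l.map f).sum := by
  obtain ⟨t, hperm, hsub⟩ := s.nodup_toList.subperm (l₂ := l) fun a ha => h a (by simpa using ha)
  rw [← Finset.sum_map_toList, ← (hperm.map f).sum_eq]
  exact (hsub.map f).sum_le_sum (by simpa using fun a _ => hf a)

/-- Rad(I) := (2/k) * sum over I of dist(i,o) is a lower bound on the
total length of every CVRP solution for (I, o, k). -/
theorem rad_le_cvrp_length (I : Finset Point) (o : Point) (k : ℕ) (hk : 1 ≤ k)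
    (tours : List (List Point)) (h : IsCVRPSolution I k tours) :
    (2 / (k : ℝ)) * ∑ i ∈ I, dist i o ≤ totalLength o tours := by
  have hk' : (0 : ℝ) < k := by exact_mod_cast hk
  rw [div_mul_eq_mul_div, div_le_iff₀' hk', Finset.mul_sum]
  calc ∑ i ∈ I, 2 * dist i o
      ≤ (tours.flatten.map fun p => 2 * dist p o).sum :=
        Finset.sum_le_list_sum_map (fun _ => by positivity)
          fun p hp => List.mem_flatten.2 (h.2 p hp)
    _ = (tours.map fun t => (t.map fun p => 2 * dist p o).sum).sum := by
        rw [List.map_flatten, List.sum_flatten, List.map_map]; rfl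
    _ ≤ (tours.map fun t => k * tourLength o t).sum :=
        List.sum_le_sum fun t ht => two_mul_sum_dist_le_tourLength o (h.1 t ht)
    _ = k * totalLength o tours := List.sum_map_mul_left ..
end
end

section
/- Let I be a finite set of n points in the Euclidean plane, let o be a depot point, and let k ≥ 1 be an integer. Suppose there is a list π enumerating all points of I (each point exactly once) whose tour length from o equals T. Then there exists a CVRP solution for (I, o, k) consisting of at most ⌊n/k⌋ + 1 tours whose total length is at most (2/k) · Σ_{i ∈ I} dist(i, o) + 2T. (This is the guarantee of the TSP-partitioning heuristic: its cost is at most Rad(I) + 2·TSP(I ∪ {o}).) -/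
open scoped BigOperators

noncomputable section

/-- The length of the polygonal path through the points of a list, in order. -/
def pathLength {X : Type*} [PseudoMetricSpace X] : List X → ℝ
  | [] => 0
  | [_] => 0
  | a :: b :: l => dist a b + pathLength (b :: l)

section PathLength

variable {X : Type*} [PseudoMetricSpace X]

lemma pathLength_append_cons (u v : List X) (i : X) :
    pathLength (u ++ i :: v) = pathLength (u ++ [i]) + pathLength (i :: v) := by
  induction u with
  | nil => simp [pathLength]
  | cons a u ih =>
    cases u with
    | nil => simp [pathLength]
    | cons b u =>
      simp only [List.cons_append, pathLength] at ih ⊢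
      rw [ih]
      ring

lemma pathLength_le_cons (a : X) (l : List X) : pathLength l ≤ pathLength (a :: l) := by
  cases l with
  | nil => simp [pathLength]
  | cons b l => simp [pathLength]

lemma pathLength_add_le_append (u v : List X) :
    pathLength u + pathLength v ≤ pathLength (u ++ v) := by
  induction u with
  | nil => simp [pathLength]
  | cons a u ih =>
    cases u with
    | nil => simpa [pathLength] using pathLength_le_cons a v
    | cons b u =>
      simp only [List.cons_append, pathLength] at ih ⊢
      linarith

lemma dist_le_pathLength (a x : X) (l : List X) : dist a x ≤ pathLength (a :: (l ++ [x])) := by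
  induction l generalizing a with
  | nil => simp [pathLength]
  | cons b l ih =>
    simp only [List.cons_append, pathLength]
    linarith [ih b, dist_triangle a b x]

lemma pathLength_cons_append_singleton_le (o i : X) (u : List X) :
    pathLength (o :: (u ++ [i])) ≤ dist i o + 2 * pathLength (u ++ [i]) := by
  cases u with
  | nil => simp [pathLength, dist_comm]
  | cons a u =>
    simp only [List.cons_append, pathLength]
    linarith [dist_le_pathLength a i u, dist_triangle o i a, dist_comm o i, dist_comm i a]

lemma pathLength_append_singleton_le (o i : X) (v : List X) :
    pathLength (i :: (v ++ [o])) ≤ dist i o + 2 * pathLength (i :: v) := by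
  induction v generalizing i with
  | nil => simp [pathLength]
  | cons a v ih =>
    simp only [List.cons_append, pathLength]
    linarith [ih a, dist_triangle a i o, dist_comm a i]

lemma pathLength_closed_le_of_mem {o i : X} {s : List X} (hi : i ∈ s) :
    pathLength (o :: (s ++ [o])) ≤ 2 * dist i o + 2 * pathLength s := by
  obtain ⟨u, v, rfl⟩ := List.append_of_mem hi
  have h₁ := pathLength_append_cons (o :: u) (v ++ [o]) i
  have h₂ := pathLength_append_cons u v i
  simp only [List.cons_append, List.append_assoc] at h₁ ⊢
  linarith [pathLength_cons_append_singleton_le o i u, pathLength_append_singleton_le o i v]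

lemma pathLength_closed_le_average {o : X} {k : ℕ} (hk : 1 ≤ k) {s : List X}
    (hs : s.length = k) :
    pathLength (o :: (s ++ [o])) ≤
      (2 / (k : ℝ)) * (s.map (dist · o)).sum + 2 * pathLength s := by
  have hk' : (0 : ℝ) < k := by exact_mod_cast hk
  have h := List.card_nsmul_le_sum (s.map (dist · o))
    ((pathLength (o :: (s ++ [o])) - 2 * pathLength s) / 2) (by
      intro x hx
      obtain ⟨i, hi, rfl⟩ := List.mem_map.1 hx
      linarith [pathLength_closed_le_of_mem (o := o) hi])
  rw [List.length_map, hs, nsmul_eq_mul] at h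
  rw [← sub_le_iff_le_add, div_mul_eq_mul_div, le_div_iff₀ hk']
  linarith

lemma pathLength_closed_le_two_mul (o : X) (s : List X) :
    pathLength (o :: (s ++ [o])) ≤ 2 * pathLength (s ++ [o]) := by
  cases s with
  | nil => simp [pathLength]
  | cons a s =>
    simp only [List.cons_append, pathLength]
    linarith [dist_le_pathLength a o s, dist_comm a o]

end PathLength

lemma sum_zipWith_dist_eq_pathLength (p q : Point) (l : List Point) :
    (List.zipWith dist (p :: l) (l ++ [q])).sum = pathLength (p :: (l ++ [q])) := by
  induction l generalizing p with
  | nil => simp [pathLength]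
  | cons a l ih => simpa [pathLength] using ih a

lemma tourLength_eq_pathLength (o : Point) (l : List Point) :
    tourLength o l = pathLength (o :: (l ++ [o])) :=
  sum_zipWith_dist_eq_pathLength o o l

lemma exists_tours_of_list (o : Point) {k : ℕ} (hk : 1 ≤ k) (l : List Point) :
    ∃ tours : List (List Point),
      (∀ t ∈ tours, t.length ≤ k) ∧ (∀ p ∈ l, ∃ t ∈ tours, p ∈ t) ∧
      tours.length ≤ l.length / k + 1 ∧
      totalLength o tours ≤
        (2 / (k : ℝ)) * (l.map (dist · o)).sum + 2 * pathLength (l ++ [o]) := by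
  induction hn : l.length using Nat.strong_induction_on generalizing l with
  | _ n ih =>
    subst hn
    by_cases hl : l.length < k
    · refine ⟨[l], by simpa using hl.le, by simp, by simp, ?_⟩
      have hsum : 0 ≤ (2 / (k : ℝ)) * (l.map (dist · o)).sum := by
        refine mul_nonneg (by positivity) (List.sum_nonneg ?_)
        simp only [List.mem_map]
        rintro _ ⟨i, -, rfl⟩
        exact dist_nonneg
      simp only [totalLength, List.map_cons, List.map_nil, List.sum_cons, List.sum_nil, add_zero,
        tourLength_eq_pathLength]
      linarith [pathLength_closed_le_two_mul o l]
    · push Not at hl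
      obtain ⟨s, t, rfl, hs⟩ : ∃ s t, l = s ++ t ∧ s.length = k :=
        ⟨l.take k, l.drop k, (List.take_append_drop k l).symm, by simpa using hl⟩
      obtain ⟨tours, hlen, hcov, hcard, htot⟩ :=
        ih t.length (by rw [List.length_append]; omega) t rfl
      refine ⟨s :: tours, by simpa [hs] using hlen, ?_, ?_, ?_⟩
      · intro p hp
        rcases List.mem_append.1 hp with hp | hp
        · exact ⟨s, by simp, hp⟩
        · obtain ⟨u, hu, hpu⟩ := hcov p hp
          exact ⟨u, by simp [hu], hpu⟩
      · rw [List.length_append, hs, Nat.add_div_left _ hk, List.length_cons]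
        omega
      · simp only [totalLength, List.map_cons, List.sum_cons, List.map_append, List.sum_append,
          tourLength_eq_pathLength o s, List.append_assoc, mul_add] at htot ⊢
        linarith [pathLength_closed_le_average (o := o) hk hs,
          pathLength_add_le_append s (t ++ [o])]

/-- The TSP-partitioning heuristic: from a salesman tour of length T one obtains
a CVRP solution with at most ⌊n/k⌋ + 1 tours of total length at most Rad(I) + 2T. -/
theorem tsp_partitioning_guarantee (I : Finset Point) (o : Point) (k : ℕ) (hk : 1 ≤ k)
    (π : List Point) (hnd : π.Nodup) (hmem : ∀ p, p ∈ π ↔ p ∈ I) (T : ℝ)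
    (hT : tourLength o π = T) :
    ∃ tours : List (List Point), IsCVRPSolution I k tours ∧
      tours.length ≤ I.card / k + 1 ∧
      totalLength o tours ≤ (2 / (k : ℝ)) * ∑ i ∈ I, dist i o + 2 * T := by
  obtain ⟨tours, hlen, hcov, hcard, htot⟩ := exists_tours_of_list o hk π
  obtain rfl : I = π.toFinset := by
    ext p
    simp [hmem]
  refine ⟨tours, ⟨hlen, fun p hp => hcov p ((hmem p).2 hp)⟩, ?_, ?_⟩
  · rwa [List.toFinset_card_of_nodup hnd]
  · rw [List.sum_toFinset _ hnd]
    have h := pathLength_le_cons o (π ++ [o])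
    rw [← tourLength_eq_pathLength, hT] at h
    linarith
end
end

section
/- There exists a constant c > 0 such that the following holds: for every nonempty finite set U of points in the Euclidean plane all of whose pairwise distances are at most D (D ≥ 0), there exists a list enumerating the points of U (each exactly once) whose cycle length is at most c · D · √|U|. (I.e., TSP(U) = O(d_max · √|U|) where d_max is the maximum pairwise distance in U.) -/
open scoped BigOperators

noncomputable section

/-- Inserting `p` right after `q` in a path from the head of a list to `z` adds at most
`2 * dist p q` to its length. -/
lemma sum_zipWith_dist_insert_le {α : Type*} [PseudoMetricSpace α] (z p q : α) (l₁ l₂ : List α) :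
    (List.zipWith dist (l₁ ++ q :: p :: l₂) ((l₁ ++ q :: p :: l₂).tail ++ [z])).sum ≤
      (List.zipWith dist (l₁ ++ q :: l₂) ((l₁ ++ q :: l₂).tail ++ [z])).sum + 2 * dist p q := by
  induction l₁ with
  | nil =>
    cases l₂ with
    | nil =>
      have := dist_triangle p q z
      simp only [List.nil_append, List.tail_cons, List.cons_append, List.zipWith_cons_cons,
        List.zipWith_nil_left, List.sum_cons, List.sum_nil]
      linarith [dist_comm p q]
    | cons r l₂ =>
      have := dist_triangle p q r
      simp only [List.nil_append, List.tail_cons, List.cons_append, List.zipWith_cons_cons,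
        List.sum_cons]
      linarith [dist_comm p q]
  | cons x l₁ ih =>
    cases l₁ with
    | nil =>
      simp only [List.nil_append, List.tail_cons, List.cons_append, List.zipWith_cons_cons,
        List.sum_cons] at ih ⊢
      linarith
    | cons y l₁ =>
      simp only [List.tail_cons, List.cons_append, List.zipWith_cons_cons, List.sum_cons] at ih ⊢
      linarith

lemma cycleLength_insert_le (p q : Point) (l₁ l₂ : List Point) :
    cycleLength (l₁ ++ q :: p :: l₂) ≤ cycleLength (l₁ ++ q :: l₂) + 2 * dist p q := by
  cases l₁ with
  | nil => exact sum_zipWith_dist_insert_le q p q [] l₂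
  | cons x l₁ => exact sum_zipWith_dist_insert_le x p q (x :: l₁) l₂

lemma dist_le_two_mul_of_abs_sub_le {p q : Point} {s : ℝ} (h : ∀ i, |p i - q i| ≤ s) :
    dist p q ≤ 2 * s := by
  have hs : 0 ≤ s := (abs_nonneg _).trans (h 0)
  rw [EuclideanSpace.dist_eq, Fin.sum_univ_two]
  refine Real.sqrt_le_iff.2 ⟨by positivity, ?_⟩
  have h0 := pow_le_pow_left₀ (abs_nonneg _) (h 0) 2
  have h1 := pow_le_pow_left₀ (abs_nonneg _) (h 1) 2
  simp only [Real.dist_eq]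
  nlinarith [sq_nonneg s]

lemma abs_sub_apply_le_dist (p q : Point) (i : Fin 2) : |p i - q i| ≤ dist p q := by
  simpa [dist_eq_norm] using PiLp.norm_apply_le (p - q) i

/-- Two points of a planar set of `n ≥ 2` points with pairwise distances at most `D` lie within
`12 * D / √n` of each other, by the pigeonhole principle on a square grid. -/
lemma exists_dist_le_of_pairwise_dist_le {U : Finset Point} {D : ℝ} (hU : 2 ≤ U.card)
    (hD : ∀ p ∈ U, ∀ q ∈ U, dist p q ≤ D) :
    ∃ p ∈ U, ∃ q ∈ U, p ≠ q ∧ dist p q ≤ 12 * D / √U.card := by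
  obtain ⟨a, ha, b, hb, hab⟩ := Finset.one_lt_card.1 hU
  have hDpos : 0 < D := (dist_pos.2 hab).trans_le (hD a ha b hb)
  set m := Nat.sqrt (U.card - 1) with hm
  have hm1 : 1 ≤ m := Nat.le_sqrt.2 (by omega)
  have hmlt : m * m < U.card := by
    have := Nat.sqrt_le (U.card - 1)
    rw [← hm] at this
    omega
  have hmR : (1 : ℝ) ≤ m := by exact_mod_cast hm1
  have hsqrt : √(U.card : ℝ) ≤ 2 * m := by
    refine Real.sqrt_le_iff.2 ⟨by positivity, ?_⟩
    have h : U.card ≤ (m + 1) * (m + 1) := by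
      have := Nat.lt_succ_sqrt (U.card - 1)
      simp only [Nat.succ_eq_add_one, ← hm] at this
      omega
    have : (U.card : ℝ) ≤ (m + 1) * (m + 1) := by exact_mod_cast h
    nlinarith
  set s : ℝ := 3 * D / m with hs
  have hspos : 0 < s := by positivity
  let cell : Point → Fin 2 → ℤ := fun p i => ⌊(p i - a i + D) / s⌋
  have hmaps : Set.MapsTo cell U (Fintype.piFinset fun _ : Fin 2 => Finset.Ico (0 : ℤ) m) := by
    intro p hp
    simp only [Finset.mem_coe, Fintype.mem_piFinset, Finset.mem_Ico]
    intro i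
    have := abs_le.1 ((abs_sub_apply_le_dist p a i).trans (hD p hp a ha))
    refine ⟨Int.floor_nonneg.2 (div_nonneg (by linarith) hspos.le), Int.floor_lt.2 ?_⟩
    rw [div_lt_iff₀ hspos, hs]
    push_cast
    rw [mul_div_cancel₀ _ (by positivity)]
    linarith
  obtain ⟨p, hp, q, hq, hpq, hcell⟩ :=
    Finset.exists_ne_map_eq_of_card_lt_of_maps_to (by simpa [sq] using hmlt) hmaps
  refine ⟨p, hp, q, hq, hpq, ?_⟩
  have hclose : ∀ i, |p i - q i| ≤ s := by
    intro i
    have h := Int.abs_sub_lt_one_of_floor_eq_floor (congrFun hcell i)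
    rw [← sub_div, abs_div, abs_of_pos hspos, div_lt_one hspos, add_sub_add_right_eq_sub,
      sub_sub_sub_cancel_right] at h
    exact h.le
  have hcard : 0 < √(U.card : ℝ) := Real.sqrt_pos.2 (by exact_mod_cast (by omega : 0 < U.card))
  calc dist p q ≤ 2 * s := dist_le_two_mul_of_abs_sub_le hclose
    _ = 12 * D / (2 * m) := by rw [hs]; field_simp; norm_num
    _ ≤ 12 * D / √U.card := by gcongr

lemma one_div_sqrt_add_one_le {x : ℝ} (hx : 0 ≤ x) : 1 / √(x + 1) ≤ 2 * (√(x + 1) - √x) := by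
  have h : 0 < √(x + 1) := Real.sqrt_pos.2 (by linarith)
  rw [div_le_iff₀ h]
  nlinarith [Real.sq_sqrt hx, Real.sq_sqrt (by linarith : 0 ≤ x + 1), sq_nonneg (√(x + 1) - √x)]

/-- TSP(U) = O(d_max * sqrt |U|): a nonempty finite set of points with pairwise
distances at most D admits a tour of length at most c * D * sqrt |U|. -/
theorem tsp_sqrt_bound :
    ∃ c : ℝ, 0 < c ∧
      ∀ (U : Finset Point) (D : ℝ), U.Nonempty → 0 ≤ D →
        (∀ p ∈ U, ∀ q ∈ U, dist p q ≤ D) →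
        ∃ l : List Point, l.Nodup ∧ (∀ p, p ∈ l ↔ p ∈ U) ∧
          cycleLength l ≤ c * D * Real.sqrt U.card := by
  classical
  refine ⟨48, by norm_num, fun U D hU _ hD => ?_⟩
  obtain ⟨n, hn⟩ : ∃ n, U.card = n + 1 := ⟨U.card - 1, by have := hU.card_pos; omega⟩
  clear hU
  induction n generalizing U with
  | zero =>
    obtain ⟨p, rfl⟩ := Finset.card_eq_one.1 hn
    refine ⟨[p], by simp, by simp, ?_⟩
    have : 0 ≤ D := by simpa using hD p (by simp) p (by simp)
    simpa [cycleLength] using this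
  | succ n ih =>
    obtain ⟨p, hp, q, hq, hpq, hdist⟩ := exists_dist_le_of_pairwise_dist_le (by omega) hD
    have hDnonneg : 0 ≤ D := dist_nonneg.trans (hD p hp q hq)
    have hcard : (U.erase p).card = n + 1 := by rw [Finset.card_erase_of_mem hp]; omega
    obtain ⟨l, hnodup, hmem, hlen⟩ := ih (U.erase p)
      (fun x hx y hy => hD x (Finset.mem_of_mem_erase hx) y (Finset.mem_of_mem_erase hy)) hcard
    have hpl : p ∉ l := by simp [hmem]
    obtain ⟨l₁, l₂, rfl⟩ := List.append_of_mem ((hmem q).2 (Finset.mem_erase.2 ⟨hpq.symm, hq⟩))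
    have hperm : (l₁ ++ q :: p :: l₂).Perm (p :: (l₁ ++ q :: l₂)) := by
      simpa using List.perm_middle (a := p) (l₁ := l₁ ++ [q]) (l₂ := l₂)
    refine ⟨l₁ ++ q :: p :: l₂, hperm.nodup_iff.2 (List.nodup_cons.2 ⟨hpl, hnodup⟩),
      fun x => ?_, (cycleLength_insert_le p q l₁ l₂).trans ?_⟩
    · rw [hperm.mem_iff, List.mem_cons, hmem, Finset.mem_erase]
      by_cases hx : x = p <;> simp [hx, hp]
    · rw [hcard] at hlen
      rw [hn] at hdist ⊢
      push_cast at hlen hdist ⊢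
      have hstep := mul_le_mul_of_nonneg_left
        (one_div_sqrt_add_one_le (by positivity : (0 : ℝ) ≤ n + 1)) hDnonneg
      rw [mul_div_assoc, div_eq_mul_one_div D] at hdist
      linarith
end
end

section
/- Let n ≥ 1 and k ≥ 1 be integers and let w : {0,…,n−1} → ℝ be any real-valued weight function. If p is chosen uniformly at random from {0,…,n−1}, then the expected value of Σ_{q : k divides ((q − p) mod n)} w(q) equals (⌈n/k⌉ / n) · Σ_{q<n} w(q). (This is the averaging step in the analysis of the TSP-partitioning 3-approximation: each point becomes a detour/breakpoint in exactly ⌈n/k⌉ of the n rotations.) -/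
open scoped BigOperators

noncomputable section

/-- There are `⌈n / k⌉` multiples of `k` below `n`. -/
theorem card_filter_dvd_range (n k : ℕ) (hk : 1 ≤ k) :
    ((Finset.range n).filter (fun r => k ∣ r)).card = (n + k - 1) / k := by
  have hlt : ∀ j, j < (n + k - 1) / k ↔ j * k < n := by
    intro j
    rw [← Nat.succ_le_iff, Nat.le_div_iff_mul_le hk, Nat.succ_mul]
    omega
  rw [← Finset.card_range ((n + k - 1) / k)]
  refine Finset.card_nbij' (· / k) (· * k) ?_ ?_ ?_ ?_
  · intro r hr
    simp only [Finset.coe_filter, Finset.mem_range, Set.mem_ofPred_eq] at hr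
    simp only [Finset.coe_range, Set.mem_Iio, hlt, Nat.div_mul_cancel hr.2, hr.1]
  · intro j hj
    simp only [Finset.coe_range, Set.mem_Iio, hlt] at hj
    simp [hj]
  · intro r hr
    simp only [Finset.coe_filter, Finset.mem_range, Set.mem_ofPred_eq] at hr
    exact Nat.div_mul_cancel hr.2
  · intro j _
    exact Nat.mul_div_cancel j hk

/-- Each index `q` is a breakpoint in exactly `⌈n / k⌉` of the `n` rotations. -/
theorem card_filter_dvd_sub_emod (n k q : ℕ) (hk : 1 ≤ k) (hq : q < n) :
    ((Finset.range n).filter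
      (fun p : ℕ => (k : ℤ) ∣ (((q : ℤ) - (p : ℤ)) % (n : ℤ)))).card = (n + k - 1) / k := by
  have hn : (0 : ℤ) < n := by omega
  have hcast : ∀ p : ℕ, ((((q : ℤ) - p) % n).toNat : ℤ) = ((q : ℤ) - p) % n :=
    fun p => Int.toNat_of_nonneg (Int.emod_nonneg _ hn.ne')
  have hlt : ∀ p : ℕ, (((q : ℤ) - p) % n).toNat < n := by
    intro p
    have := hcast p
    have := Int.emod_lt_of_pos ((q : ℤ) - p) hn
    omega
  have hinv : ∀ p < n, (((q : ℤ) - ((((q : ℤ) - p) % n).toNat : ℕ)) % n).toNat = p := by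
    intro p hp
    have h : ((q : ℤ) - ((q : ℤ) - p) % n) % n = p := by
      rw [Int.sub_emod, Int.emod_emod, ← Int.sub_emod, sub_sub_cancel]
      exact Int.emod_eq_of_lt (by omega) (by omega)
    rw [hcast, h, Int.toNat_natCast]
  rw [← card_filter_dvd_range n k hk]
  refine Finset.card_nbij' (fun p => (((q : ℤ) - p) % n).toNat)
    (fun p => (((q : ℤ) - p) % n).toNat) ?_ ?_ ?_ ?_
  · intro p hp
    simp only [Finset.coe_filter, Finset.mem_range, Set.mem_ofPred_eq] at hp ⊢
    refine ⟨hlt p, ?_⟩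
    rw [← Int.natCast_dvd_natCast, hcast]
    exact hp.2
  · intro r hr
    simp only [Finset.coe_filter, Finset.mem_range, Set.mem_ofPred_eq] at hr ⊢
    refine ⟨hlt r, ?_⟩
    rw [← hcast, hinv r hr.1]
    exact Int.natCast_dvd_natCast.mpr hr.2
  · intro p hp
    exact hinv p (Finset.mem_range.mp (Finset.mem_filter.mp hp).1)
  · intro r hr
    exact hinv r (Finset.mem_range.mp (Finset.mem_filter.mp hr).1)

/-- Averaging identity for the TSP-partitioning heuristic: for a uniformly
random rotation p of n cyclically arranged points, the expected total weight of
the breakpoints (indices q with (q − p) mod n divisible by k) equals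
(⌈n/k⌉ / n) times the total weight. -/
theorem expected_breakpoint_weight (n k : ℕ) (hn : 1 ≤ n) (hk : 1 ≤ k) (w : ℕ → ℝ) :
    (∑ p ∈ Finset.range n,
        ∑ q ∈ (Finset.range n).filter
          (fun q : ℕ => (k : ℤ) ∣ (((q : ℤ) - (p : ℤ)) % (n : ℤ))), w q) / (n : ℝ)
      = (((n + k - 1) / k : ℕ) : ℝ) / (n : ℝ) * ∑ q ∈ Finset.range n, w q := by
  rw [div_mul_eq_mul_div]
  congr 1
  simp_rw [Finset.sum_filter]
  rw [Finset.sum_comm, Finset.mul_sum]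
  refine Finset.sum_congr rfl fun q hq => ?_
  rw [← Finset.sum_filter, Finset.sum_const,
    card_filter_dvd_sub_emod n k q hk (Finset.mem_range.mp hq), nsmul_eq_mul]
end
end

section
/- Let I be a finite set of n points in the Euclidean plane, let o be a depot point, and let k ≥ 1 be an integer. For every CVRP solution S for (I, o, k), there exists a CVRP solution for (I, o, k) consisting of at most ⌊n/k⌋ + 1 tours whose total length is at most 3 times the total length of S. (The TSP-partitioning algorithm is a 3-approximation for Euclidean capacitated vehicle routing.) -/
open scoped BigOperators

noncomputable section

/-- The length of the walk from `a` to `b` visiting the points of `l` in order. -/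
def walkLength (a : Point) : List Point → Point → ℝ
  | [], b => dist a b
  | p :: l, b => dist a p + walkLength p l b

theorem tourLength_eq_walkLength (o : Point) (l : List Point) :
    tourLength o l = walkLength o l o := by
  have key : ∀ (l : List Point) (a b : Point),
      (List.zipWith dist (a :: l) (l ++ [b])).sum = walkLength a l b := by
    intro l
    induction l with
    | nil => intro a b; simp [walkLength]
    | cons p l ih => intro a b; simpa [walkLength] using ih p b
  exact key l o o

theorem dist_le_walkLength (a b : Point) (l : List Point) : dist a b ≤ walkLength a l b := by
  induction l generalizing a with
  | nil => exact le_rfl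
  | cons p l ih => exact (dist_triangle a p b).trans (by simpa [walkLength] using ih p)

theorem walkLength_le_dist_add (a p b : Point) (l : List Point) :
    walkLength a l b ≤ dist a p + walkLength p l b := by
  cases l with
  | nil => exact dist_triangle a p b
  | cons r l =>
    have := dist_triangle a p r
    simp only [walkLength]
    linarith

theorem walkLength_mono {l l' : List Point} (h : l'.Sublist l) (a b : Point) :
    walkLength a l' b ≤ walkLength a l b := by
  induction h generalizing a with
  | slnil => exact le_rfl
  | cons p _ ih =>
    exact (walkLength_le_dist_add a p b _).trans (by simpa [walkLength] using ih p)
  | cons_cons p _ ih => simpa [walkLength] using ih p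

theorem walkLength_append_cons (a p b : Point) (l₁ l₂ : List Point) :
    walkLength a (l₁ ++ p :: l₂) b = walkLength a l₁ p + walkLength p l₂ b := by
  induction l₁ generalizing a with
  | nil => rfl
  | cons r l ih => simp [walkLength, ih, add_assoc]

theorem walkLength_flatten_le (o : Point) (S : List (List Point)) :
    walkLength o S.flatten o ≤ totalLength o S := by
  induction S with
  | nil => simp [walkLength, totalLength]
  | cons t S ih =>
    have h : walkLength o (t ++ S.flatten) o ≤ walkLength o (t ++ o :: S.flatten) o :=
      walkLength_mono ((List.Sublist.refl t).append (List.sublist_cons_self o _)) o o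
    rw [walkLength_append_cons] at h
    simp only [totalLength, List.map_cons, List.sum_cons, List.flatten_cons,
      tourLength_eq_walkLength o t] at ih ⊢
    linarith

theorem two_mul_dist_le_walkLength {o p : Point} {l : List Point} (hp : p ∈ l) :
    2 * dist o p ≤ walkLength o l o := by
  have h := walkLength_mono (List.singleton_sublist.2 hp) o o
  simp only [walkLength, dist_comm p o] at h
  linarith

theorem two_mul_sum_dist_flatten_le (o : Point) (k : ℕ) (S : List (List Point))
    (hS : ∀ t ∈ S, t.length ≤ k) :
    2 * (S.flatten.map (dist o)).sum ≤ k * totalLength o S := by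
  induction S with
  | nil => simp [totalLength]
  | cons t S ih =>
    have hS' := ih fun t ht => hS t (List.mem_cons_of_mem _ ht)
    have hk : (t.length : ℝ) ≤ k := by exact_mod_cast hS t List.mem_cons_self
    have hw : 0 ≤ walkLength o t o := dist_nonneg.trans (dist_le_walkLength o o t)
    have ht : (t.map (dist o)).sum ≤ t.length * (walkLength o t o / 2) := by
      have := List.sum_le_card_nsmul (t.map (dist o)) (walkLength o t o / 2) (by
        intro d hd
        obtain ⟨p, hp, rfl⟩ := List.mem_map.1 hd
        linarith [two_mul_dist_le_walkLength (o := o) hp])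
      simpa using this
    have := mul_le_mul_of_nonneg_right hk hw
    simp only [totalLength, List.map_cons, List.sum_cons, List.flatten_cons, List.map_append,
      List.sum_append, tourLength_eq_walkLength o t] at hS' ⊢
    linarith

theorem walkLength_map_range' (x : ℕ → Point) (b : Point) (a m : ℕ) :
    walkLength (x a) ((List.range' (a + 1) m).map x) b =
      ∑ i ∈ Finset.Ico a (a + m), dist (x i) (x (i + 1)) + dist (x (a + m)) b := by
  induction m generalizing a with
  | zero => simp [walkLength]
  | succ m ih =>
    rw [List.range'_succ, List.map_cons, walkLength, ih (a + 1),
      Finset.sum_eq_sum_Ico_succ_bot (by omega : a < a + (m + 1)),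
      show a + 1 + m = a + (m + 1) by omega, add_assoc]

theorem walkLength_map_range'_succ (x : ℕ → Point) (o : Point) (a m : ℕ) :
    walkLength o ((List.range' a (m + 1)).map x) o =
      dist o (x a) + ∑ i ∈ Finset.Ico a (a + m), dist (x i) (x (i + 1)) +
        dist o (x (a + m)) := by
  rw [List.range'_succ, List.map_cons, walkLength, walkLength_map_range', dist_comm o (x (a + m)),
    add_assoc]

theorem walkLength_map_range'_le (x : ℕ → Point) (o : Point) {a b : ℕ} (hab : a ≤ b) :
    walkLength o ((List.range' a (b - a)).map x) o ≤
      dist o (x a) + ∑ i ∈ Finset.Ico a b, dist (x i) (x (i + 1)) + dist o (x (b - 1)) := by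
  obtain ⟨m, rfl⟩ := Nat.exists_eq_add_of_le hab
  cases m with
  | zero => simp [walkLength]; positivity
  | succ m =>
    rw [Nat.add_sub_cancel_left, walkLength_map_range'_succ]
    have : ∑ i ∈ Finset.Ico a (a + m), dist (x i) (x (i + 1)) ≤
        ∑ i ∈ Finset.Ico a (a + (m + 1)), dist (x i) (x (i + 1)) :=
      Finset.sum_le_sum_of_subset_of_nonneg (Finset.Ico_subset_Ico_right (by omega))
        fun _ _ _ => dist_nonneg
    simp only [show a + (m + 1) - 1 = a + m by omega]
    linarith

theorem Function.Periodic.sum_range_add {f : ℕ → ℝ} {n : ℕ} (hf : Function.Periodic f n) (t : ℕ) :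
    ∑ i ∈ Finset.range n, f (i + t) = ∑ i ∈ Finset.range n, f i := by
  induction t with
  | zero => rfl
  | succ t ih =>
    have h := Finset.sum_range_succ (fun i => f (i + t)) n
    rw [Finset.sum_range_succ', show f (n + t) = f (0 + t) by
      rw [add_comm n t, hf t, zero_add]] at h
    rw [← ih, ← add_right_cancel h]
    exact Finset.sum_congr rfl fun i _ => by rw [add_assoc, add_comm 1 t]

theorem sum_map_list_range (f : ℕ → ℝ) (n : ℕ) :
    ((List.range n).map f).sum = ∑ i ∈ Finset.range n, f i := by
  induction n with
  | zero => rfl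
  | succ n ih => simp [List.range_succ, Finset.sum_range_succ, ih]

/-- The partition of the cyclic sequence `x 0, …, x (n - 1)`, read from `x j` on, into `q + 1`
consecutive groups of at most `k` points. -/
def cyclicPartition (x : ℕ → Point) (n k q j : ℕ) : List (List Point) :=
  (List.range (q + 1)).map fun c =>
    (List.range' (j + min (c * k) n) (j + min ((c + 1) * k) n - (j + min (c * k) n))).map x

theorem min_mul_le_min_succ_mul (n k c : ℕ) : min (c * k) n ≤ min ((c + 1) * k) n :=
  min_le_min_right n (Nat.mul_le_mul_right k c.le_succ)

theorem length_le_of_mem_cyclicPartition {x : ℕ → Point} {n k q j : ℕ} {t : List Point}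
    (ht : t ∈ cyclicPartition x n k q j) : t.length ≤ k := by
  obtain ⟨c, -, rfl⟩ := List.mem_map.1 ht
  simp only [List.length_map, List.length_range', Nat.succ_mul]
  omega

theorem exists_mem_cyclicPartition {x : ℕ → Point} {n k q j i : ℕ} (hx : Function.Periodic x n)
    (hk : 1 ≤ k) (hq : n < (q + 1) * k) (hj : j < n) (hi : i < n) :
    ∃ t ∈ cyclicPartition x n k q j, x i ∈ t := by
  obtain ⟨s, hs, hxs⟩ : ∃ s < n, x (j + s) = x i := by
    rcases le_or_gt j i with h | h
    · exact ⟨i - j, by omega, by rw [Nat.add_sub_cancel' h]⟩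
    · exact ⟨i + n - j, by omega, by rw [Nat.add_sub_cancel' (by omega), hx i]⟩
  refine ⟨_, List.mem_map.2 ⟨s / k, List.mem_range.2 ?_, rfl⟩, List.mem_map.2 ⟨j + s, ?_, hxs⟩⟩
  · exact (Nat.div_lt_iff_lt_mul hk).2 (hs.trans hq)
  · have h₁ : s / k * k ≤ s := Nat.div_mul_le_self s k
    have h₂ : s < (s / k + 1) * k := Nat.lt_mul_of_div_lt (Nat.lt_succ_self _) hk
    rw [List.mem_range'_1]
    omega

theorem totalLength_cyclicPartition_le (x : ℕ → Point) (o : Point) {n k q j : ℕ} (hn : 1 ≤ n)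
    (hk : 1 ≤ k) (hq : n ≤ (q + 1) * k) :
    totalLength o (cyclicPartition x n k q j) ≤
      ∑ i ∈ Finset.Ico j (j + n), dist (x i) (x (i + 1)) +
        ∑ c ∈ Finset.range (q + 1), (dist o (x (j + min (c * k) n)) +
          dist o (x (j + (min ((c + 1) * k) n - 1)))) := by
  have hpath : ∀ r, ∑ c ∈ Finset.range r, ∑ i ∈ Finset.Ico (j + min (c * k) n)
      (j + min ((c + 1) * k) n), dist (x i) (x (i + 1)) =
        ∑ i ∈ Finset.Ico j (j + min (r * k) n), dist (x i) (x (i + 1)) := by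
    intro r
    induction r with
    | zero => simp
    | succ r ih =>
      rw [Finset.sum_range_succ, ih, Finset.sum_Ico_consecutive _ (by omega)
        (Nat.add_le_add_left (min_mul_le_min_succ_mul n k r) j)]
  have hp := hpath (q + 1)
  rw [min_eq_right hq] at hp
  rw [← hp, ← Finset.sum_add_distrib, totalLength, cyclicPartition, List.map_map,
    sum_map_list_range]
  refine Finset.sum_le_sum fun c _ => ?_
  have h := walkLength_map_range'_le x o
    (Nat.add_le_add_left (min_mul_le_min_succ_mul n k c) j)
  have hpos : 1 ≤ min ((c + 1) * k) n := le_min (Nat.mul_pos c.succ_pos hk) hn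
  rw [Nat.add_sub_assoc hpos] at h
  simp only [Function.comp_apply, tourLength_eq_walkLength]
  linarith

theorem exists_totalLength_cyclicPartition_le {x : ℕ → Point} (o : Point) {n k q : ℕ}
    (hx : Function.Periodic x n) (hn : 1 ≤ n) (hk : 1 ≤ k) (hq : n ≤ (q + 1) * k) :
    ∃ j < n, n * totalLength o (cyclicPartition x n k q j) ≤
      n * ∑ i ∈ Finset.range n, dist (x i) (x (i + 1)) +
        (q + 1) * (2 * ∑ i ∈ Finset.range n, dist o (x i)) := by
  set E := ∑ i ∈ Finset.range n, dist (x i) (x (i + 1)) with hE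
  set D := ∑ i ∈ Finset.range n, dist o (x i) with hD
  have hd : Function.Periodic (fun i => dist o (x i)) n := fun i => by
    simp only [hx i]
  have he : Function.Periodic (fun i => dist (x i) (x (i + 1))) n := fun i => by
    simp only [hx i, show i + n + 1 = i + 1 + n by omega, hx (i + 1)]
  have hshift : ∀ t, ∑ j ∈ Finset.range n, dist o (x (j + t)) = D := hd.sum_range_add
  have hcycle : ∀ j, ∑ i ∈ Finset.Ico j (j + n), dist (x i) (x (i + 1)) = E := by
    intro j
    rw [Finset.sum_Ico_eq_sum_range, Nat.add_sub_cancel_left, hE, ← he.sum_range_add j]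
    simp only [add_comm j]
  have hsum : ∑ j ∈ Finset.range n, totalLength o (cyclicPartition x n k q j) ≤
      n * E + (q + 1) * (2 * D) := by
    refine (Finset.sum_le_sum fun j _ => totalLength_cyclicPartition_le x o hn hk hq).trans ?_
    rw [Finset.sum_add_distrib, Finset.sum_comm]
    simp only [hcycle, Finset.sum_add_distrib, hshift, Finset.sum_const, Finset.card_range,
      nsmul_eq_mul]
    push_cast
    linarith
  have hn' : (0 : ℝ) < n := by exact_mod_cast hn
  obtain ⟨j, hj, hle⟩ := Finset.exists_le_of_sum_le (s := Finset.range n)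
    (f := fun j => totalLength o (cyclicPartition x n k q j))
    (g := fun _ => (n * E + (q + 1) * (2 * D)) / n) (Finset.nonempty_range_iff.2 (by omega)) (by
      rw [Finset.sum_const, Finset.card_range, nsmul_eq_mul, mul_div_cancel₀ _ hn'.ne']
      exact hsum)
  refine ⟨j, Finset.mem_range.1 hj, ?_⟩
  rw [mul_comm]
  exact (le_div_iff₀ hn').1 hle

theorem exists_periodic_map_range_eq (o : Point) (l : List Point) :
    ∃ x : ℕ → Point, Function.Periodic x l.length ∧ l = (List.range' 0 l.length).map x := by
  refine ⟨fun i => l.getD (i % l.length) o, fun i => by simp, ?_⟩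
  refine List.ext_getElem (by simp) fun i h₁ h₂ => ?_
  simp [Nat.mod_eq_of_lt h₁, h₁]

theorem sum_range_dist_succ_le_walkLength {x : ℕ → Point} (o : Point) {n : ℕ}
    (hx : Function.Periodic x n) :
    ∑ i ∈ Finset.range n, dist (x i) (x (i + 1)) ≤
      walkLength o ((List.range' 0 n).map x) o := by
  cases n with
  | zero => simp [walkLength]
  | succ m =>
    rw [walkLength_map_range'_succ, Finset.sum_range_succ, zero_add, Finset.range_eq_Ico,
      show x (m + 1) = x 0 by simpa using hx 0]
    have := dist_triangle_left (x m) (x 0) o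
    linarith

theorem exists_tour_order (I : Finset Point) (L : List Point) (h : ∀ p ∈ I, p ∈ L) :
    ∃ l : List Point, l.Sublist L ∧ l.length = I.card ∧ ∀ p ∈ I, p ∈ l := by
  classical
  refine ⟨(L.filter (· ∈ I)).dedup, (List.dedup_sublist _).trans List.filter_sublist, ?_, ?_⟩
  · rw [← List.toFinset_card_of_nodup (List.nodup_dedup _)]
    congr 1
    ext p
    simpa using h p
  · intro p hp
    simp [hp, h p hp]

/-- The TSP-partitioning algorithm is a 3-approximation for Euclidean
capacitated vehicle routing: every CVRP solution can be converted to one with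
at most ⌊n/k⌋ + 1 tours and total length at most 3 times as large. -/
theorem tsp_partitioning_three_approx (I : Finset Point) (o : Point) (k : ℕ) (hk : 1 ≤ k)
    (S : List (List Point)) (hS : IsCVRPSolution I k S) :
    ∃ tours : List (List Point), IsCVRPSolution I k tours ∧
      tours.length ≤ I.card / k + 1 ∧
      totalLength o tours ≤ 3 * totalLength o S := by
  obtain ⟨l, hsub, hlen, hmem⟩ := exists_tour_order I S.flatten fun p hp =>
    List.mem_flatten.2 (hS.2 p hp)
  have hwalk : walkLength o l o ≤ totalLength o S :=
    (walkLength_mono hsub o o).trans (walkLength_flatten_le o S)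
  have hL : 0 ≤ totalLength o S :=
    dist_nonneg.trans ((dist_le_walkLength o o l).trans hwalk)
  have hradial : 2 * (l.map (dist o)).sum ≤ k * totalLength o S := by
    have h := (hsub.map (dist o)).sum_le_sum fun d hd => by
      obtain ⟨p, -, rfl⟩ := List.mem_map.1 hd
      exact dist_nonneg
    linarith [two_mul_sum_dist_flatten_le o k S hS.1]
  rw [← hlen]
  rcases lt_or_ge l.length k with hlk | hkl
  · refine ⟨[l], ⟨by simpa using hlk.le, fun p hp => ⟨l, by simp, hmem p hp⟩⟩, by simp, ?_⟩
    simp only [totalLength, List.map_cons, List.map_nil, List.sum_cons, List.sum_nil, add_zero,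
      tourLength_eq_walkLength o l] at hwalk hL ⊢
    linarith
  · obtain ⟨x, hx, hl⟩ := exists_periodic_map_range_eq o l
    generalize l.length = n at *
    subst hl
    have hq : n < (n / k + 1) * k := Nat.lt_mul_of_div_lt (Nat.lt_succ_self _) hk
    have hn : 1 ≤ n := hk.trans hkl
    obtain ⟨j, hj, hle⟩ := exists_totalLength_cyclicPartition_le o hx hn hk hq.le
    refine ⟨cyclicPartition x n k (n / k) j,
      ⟨fun t ht => length_le_of_mem_cyclicPartition ht, fun p hp => ?_⟩,
      by simp [cyclicPartition], ?_⟩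
    · obtain ⟨i, hi, rfl⟩ := List.mem_map.1 (hmem p hp)
      exact exists_mem_cyclicPartition hx hk hq hj (by simpa using hi)
    · have hE := (sum_range_dist_succ_le_walkLength o hx).trans hwalk
      rw [List.map_map, ← List.range_eq_range', sum_map_list_range] at hradial
      have hcount : (((n / k : ℕ) : ℝ) + 1) * k ≤ 2 * n := by
        have : (n / k + 1) * k ≤ 2 * n := by
          have := Nat.div_mul_le_self n k
          rw [Nat.succ_mul]
          omega
        exact_mod_cast this
      have hn' : (0 : ℝ) < n := by exact_mod_cast hn
      refine le_of_mul_le_mul_left (hle.trans ?_) hn'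
      calc _ ≤ n * totalLength o S + ((n / k : ℕ) + 1) * (k * totalLength o S) := by
            have := mul_le_mul_of_nonneg_left hradial
              (by positivity : (0 : ℝ) ≤ (n / k : ℕ) + 1)
            exact add_le_add (mul_le_mul_of_nonneg_left hE hn'.le) this
        _ = n * totalLength o S + (((n / k : ℕ) + 1) * k) * totalLength o S := by ring
        _ ≤ n * totalLength o S + (2 * n) * totalLength o S := by gcongr
        _ = _ := by ring
end
end
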